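/- Let 0 < a ≤ 1/2, let k > 0, and let x be a complex number with |x| = 1 and |Im(log x)| < π/4 (principal logarithm). Define G_a(u) := Σ_{n∈ℤ} ( exp(−π x² u² (n+a)²) + exp(−π x² u² n² + 2πina) ) for complex arguments xu, and I_{x,k}(s,a) := (1/(2πi)) ∫_{s−ik}^{s+ik} π^{−v/2} Γ(v/2) Q(v,a) x^{v−1} dv. Then (1/(2πi)) ∫_{1/2−i∞}^{1/2+i∞} | I_{x,k}(s,a) |² ds = (1/π²) ∫_0^∞ | sin(k·log w)/log w |² · | G_a(xw) − 1 − 1/(xw) |² dw. -/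

import Mathlib

open Complex MeasureTheory

/-- The Hurwitz zeta function `ζ(s, a)`. -/
noncomputable def hzeta (a : ℝ) (s : ℂ) : ℂ := HurwitzZeta.hurwitzZeta (a : UnitAddCircle) s

/-- The periodic (exponential) zeta function `Li(s, a)`. -/
noncomputable def pzeta (a : ℝ) (s : ℂ) : ℂ := HurwitzZeta.expZeta (a : UnitAddCircle) s

/-- The quadrilateral zeta function `Q(s, a)`, defined by
`2Q(s,a) = ζ(s,a) + ζ(s,1−a) + Li(s,a) + Li(s,1−a)`. -/
noncomputable def Qzeta (s : ℂ) (a : ℝ) : ℂ :=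
  (hzeta a s + hzeta (1 - a) s + pzeta a s + pzeta (1 - a) s) / 2

/-- The theta-type series `G_a(z)` for a complex argument `z` in the wedge `|arg z| < π/4`. -/
noncomputable def Gc (a : ℝ) (z : ℂ) : ℂ :=
  ∑' n : ℤ, (Complex.exp (-Real.pi * z ^ 2 * (n + a) ^ 2) +
    Complex.exp (-Real.pi * z ^ 2 * n ^ 2 + 2 * Real.pi * Complex.I * n * a))

/-- The contour integral `I_{x,k}(s,a) = (1/(2πi)) ∫_{s-ik}^{s+ik} π^{-v/2} Γ(v/2) Q(v,a) x^{v-1} dv`,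
parametrized along the vertical segment `v = s + iu`, `-k ≤ u ≤ k`. -/
noncomputable def Ixk (x : ℂ) (k : ℝ) (s : ℂ) (a : ℝ) : ℂ :=
  (1 / (2 * Real.pi * Complex.I)) *
    (Complex.I * ∫ u in (-k)..k,
      (Real.pi : ℂ) ^ (-(s + Complex.I * u) / 2) * Complex.Gamma ((s + Complex.I * u) / 2) *
        Qzeta (s + Complex.I * u) a * x ^ (s + Complex.I * u - 1))


open scoped FourierTransform SchwartzMap in
lemma aux_sq_norm (F : Lp (α := ℝ) ℂ 2 volume) : ‖F‖ ^ 2 = ∫ x, ‖F x‖ ^ 2 := by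
  rw [← real_inner_self_eq_norm_sq, L2.inner_def]
  simp only [real_inner_self_eq_norm_sq]

open scoped FourierTransform SchwartzMap in
lemma aux_plancherel {f : ℝ → ℂ} (h1 : Integrable f) (h2 : MemLp f 2) :
    ∫ ξ, ‖𝓕 f ξ‖ ^ 2 = ∫ x, ‖f x‖ ^ 2 := by
  set F : Lp (α := ℝ) ℂ 2 volume := h2.toLp f with hF
  have hcont : Continuous (𝓕 f) := by
    exact VectorFourier.fourierIntegral_continuous Real.continuous_fourierChar
      (by exact continuous_inner) h1
  have hae : ∀ᵐ x, (𝓕 F : Lp (α := ℝ) ℂ 2 volume) x = 𝓕 f x := by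
    apply ae_eq_of_integral_contDiff_smul_eq
    · exact (Lp.memLp _).locallyIntegrable (by norm_num)
    · exact hcont.locallyIntegrable
    intro g hg1 hg2
    let φ : 𝓢(ℝ, ℂ) := HasCompactSupport.toSchwartzMap (f := fun x => (g x : ℂ))
      (hg2.comp_left (g := fun x : ℝ => (x : ℂ)) (by simp)) (Complex.ofRealCLM.contDiff.comp hg1)
    have hφ : ∀ x, φ x = (g x : ℂ) := fun x => rfl
    have e1 := Lp.fourier_toTemperedDistribution_eq F
    have e2 := congrArg (fun T => T φ) e1
    simp only [TemperedDistribution.fourier_apply, Lp.toTemperedDistribution_apply] at e2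
    have e3 := VectorFourier.integral_fourierIntegral_smul_eq_flip (μ := volume) (ν := volume)
      (L := innerₗ ℝ) (f := (φ : ℝ → ℂ)) (g := f) Real.continuous_fourierChar
      (by exact continuous_inner) φ.integrable h1
    rw [flip_innerₗ] at e3
    change ∫ ξ, 𝓕 (φ : ℝ → ℂ) ξ • f ξ = ∫ x, φ x • 𝓕 f x at e3
    calc ∫ x, g x • (𝓕 F : Lp (α := ℝ) ℂ 2 volume) x = ∫ x, φ x • (𝓕 F : Lp (α := ℝ) ℂ 2 volume) x := by
          simp [hφ]
      _ = ∫ x, 𝓕 φ x • F x := e2.symm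
      _ = ∫ ξ, 𝓕 (φ : ℝ → ℂ) ξ • f ξ := by
          apply integral_congr_ae
          filter_upwards [h2.coeFn_toLp] with x hx
          rw [SchwartzMap.fourier_coe, hF, hx]
      _ = _ := by rw [e3]; simp [hφ]
  calc ∫ ξ, ‖𝓕 f ξ‖ ^ 2 = ∫ ξ, ‖(𝓕 F : Lp (α := ℝ) ℂ 2 volume) ξ‖ ^ 2 := by
        apply integral_congr_ae
        filter_upwards [hae] with x hx
        rw [hx]
    _ = ∫ x, ‖F x‖ ^ 2 := by
        rw [← aux_sq_norm, ← aux_sq_norm, Lp.norm_fourier_eq]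
    _ = _ := by
        apply integral_congr_ae
        filter_upwards [h2.coeFn_toLp] with x hx
        rw [hF, hx]

lemma aux_integrableOn_rpow_exp {p b : ℝ} (hp : -1 < p) (hb : 0 < b) :
    IntegrableOn (fun t : ℝ => t ^ p * Real.exp (-b * t)) (Set.Ioi 0) := by
  have := integrableOn_rpow_mul_exp_neg_mul_rpow hp (zero_lt_one) hb
  simpa using this

lemma aux_norm_term {s r : ℂ} {t : ℝ} (ht : 0 < t) :
    ‖(t : ℂ) ^ (s - 1) * cexp (-(r * t))‖ = t ^ (s.re - 1) * Real.exp (-r.re * t) := by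
  rw [norm_mul, Complex.norm_cpow_eq_rpow_re_of_pos ht, Complex.norm_exp]
  simp

lemma aux_aesm (s r : ℂ) : AEStronglyMeasurable
    (fun t : ℝ => (t : ℂ) ^ (s - 1) * cexp (-(r * t))) (volume.restrict (Set.Ioi 0)) := by
  apply ContinuousOn.aestronglyMeasurable _ measurableSet_Ioi
  intro t ht
  apply ContinuousAt.continuousWithinAt
  apply ContinuousAt.mul
  · exact Complex.continuousAt_ofReal_cpow_const _ _ (Or.inr (ne_of_gt ht))
  · fun_prop

lemma aux_integrable_term {s r : ℂ} (hs : 0 < s.re) (hr : 0 < r.re) :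
    IntegrableOn (fun t : ℝ => (t : ℂ) ^ (s - 1) * cexp (-(r * t))) (Set.Ioi 0) := by
  have := aux_integrableOn_rpow_exp (p := s.re - 1) (by linarith) hr
  refine Integrable.mono' this (aux_aesm s r) ?_
  filter_upwards [ae_restrict_mem measurableSet_Ioi] with t ht
  rw [aux_norm_term ht]

lemma aux_gamma_complex {s r : ℂ} (hs : 0 < s.re) (hr : 0 < r.re) :
    ∫ t in Set.Ioi (0 : ℝ), (t : ℂ) ^ (s - 1) * cexp (-(r * t)) = r ^ (-s) * Gamma s := by
  let U : Set ℂ := {z | 0 < z.re}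
  have hU : IsOpen U := isOpen_lt continuous_const continuous_re
  have hUc : IsPreconnected U := (convex_halfSpace_re_gt 0).isPreconnected
  have h1 : DifferentiableOn ℂ (fun r : ℂ => ∫ t in Set.Ioi (0 : ℝ),
      (t : ℂ) ^ (s - 1) * cexp (-(r * t))) U := by
    intro r0 hr0
    have hr0' : 0 < r0.re := hr0
    apply DifferentiableAt.differentiableWithinAt
    refine (hasDerivAt_integral_of_dominated_loc_of_deriv_le (𝕜 := ℂ)
      (μ := volume.restrict (Set.Ioi (0 : ℝ)))
      (F := fun r t => (t : ℂ) ^ (s - 1) * cexp (-(r * t)))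
      (F' := fun r t => (t : ℂ) ^ (s - 1) * (cexp (-(r * t)) * (-t)))
      (bound := fun t => t ^ s.re * Real.exp (-(r0.re / 2) * t))
      (s := Metric.ball r0 (r0.re / 2)) (x₀ := r0)
      (Metric.ball_mem_nhds _ (by linarith)) (Filter.Eventually.of_forall fun r => aux_aesm s r)
      (aux_integrable_term hs hr0) ?_ ?_ ?_ ?_).2.differentiableAt
    · have := (aux_aesm s r0).mul (f := _) (g := fun t : ℝ => (-t : ℂ)) (by fun_prop)
      refine this.congr (Filter.Eventually.of_forall fun t => ?_)
      simp only [Pi.mul_apply]; ring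
    · filter_upwards [ae_restrict_mem measurableSet_Ioi] with t ht r hr
      have ht' : 0 < t := ht
      rw [← mul_assoc, norm_mul, aux_norm_term ht, norm_neg, norm_real, Real.norm_of_nonneg ht'.le]
      have e : t ^ (s.re - 1) * t = t ^ s.re := by
        rw [Real.rpow_sub_one ht'.ne']; field_simp
      rw [mul_right_comm, e]
      gcongr
      have := (abs_le.mp ((abs_re_le_norm (r - r0)).trans (mem_ball_iff_norm.mp hr).le)).1
      simp at this
      linarith
    · exact aux_integrableOn_rpow_exp (by linarith) (by linarith)
    · filter_upwards with t r hr
      have : HasDerivAt (fun r : ℂ => -(r * t)) (-t : ℂ) r := by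
        simpa using ((hasDerivAt_id r).mul_const (t : ℂ)).fun_neg
      exact (this.cexp).const_mul _
  have h2 : DifferentiableOn ℂ (fun r : ℂ => r ^ (-s) * Gamma s) U := by
    intro r0 hr0
    apply DifferentiableAt.differentiableWithinAt
    apply DifferentiableAt.mul_const
    exact (differentiableAt_id).cpow_const (Or.inl hr0)
  refine (h1.analyticOnNhd hU).eqOn_of_preconnected_of_frequently_eq (h2.analyticOnNhd hU) hUc
    (z₀ := 1) (by simp [U]) ?_ hr
  have hseq : Filter.Tendsto (fun n : ℕ => (((1 : ℝ) + 1 / ((n : ℝ) + 1) : ℝ) : ℂ)) Filter.atTop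
      (nhdsWithin 1 {1}ᶜ) := by
    apply tendsto_nhdsWithin_of_tendsto_nhds_of_eventually_within
    · have := (tendsto_one_div_add_atTop_nhds_zero_nat (𝕜 := ℝ)).const_add 1
      rw [add_zero] at this
      have h3 := (continuous_ofReal.tendsto 1).comp this
      simpa [Function.comp_def] using h3
    · refine Filter.Eventually.of_forall fun n => ?_
      have : (0 : ℝ) < 1 / ((n : ℝ) + 1) := by positivity
      simp only [Set.mem_compl_iff, Set.mem_singleton_iff]
      intro h
      have h' : (1 : ℝ) + 1 / ((n : ℝ) + 1) = 1 := by exact_mod_cast h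
      linarith
  refine hseq.frequently (Filter.Frequently.of_forall fun n => ?_)
  have hp : (0 : ℝ) < 1 + 1 / ((n : ℝ) + 1) := by positivity
  have := Complex.integral_cpow_mul_exp_neg_mul_Ioi (a := s) hs hp
  rw [this, one_div, cpow_neg, inv_cpow]
  rw [arg_ofReal_of_nonneg hp.le]
  exact Real.pi_pos.ne

lemma aux_ofReal_mul_cpow {r : ℝ} (hr : 0 < r) {z : ℂ} (hz : z ≠ 0) (s : ℂ) :
    ((r : ℂ) * z) ^ s = (r : ℂ) ^ s * z ^ s := by
  have hr0 : (r : ℂ) ≠ 0 := by exact_mod_cast hr.ne'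
  rw [cpow_def_of_ne_zero (mul_ne_zero hr0 hz), cpow_def_of_ne_zero hr0, cpow_def_of_ne_zero hz,
    log_ofReal_mul hr hz, ← Complex.exp_add, ofReal_log hr.le, add_mul]

/-- theta -/
noncomputable def auxTh (a : ℝ) (z : ℂ) : ℂ :=
  cexp (-Real.pi * a ^ 2 * z) * jacobiTheta₂ (a * I * z) (I * z) + jacobiTheta₂ a (I * z)

lemma auxTh_hasSum (a : ℝ) {z : ℂ} (hz : 0 < z.re) :
    HasSum (fun n : ℤ => cexp (-Real.pi * z * (n + a) ^ 2) +
      cexp (-Real.pi * z * n ^ 2 + 2 * Real.pi * I * n * a)) (auxTh a z) := by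
  have him : 0 < (I * z).im := by simpa using hz
  apply HasSum.add
  · refine ((hasSum_jacobiTheta₂_term (a * I * z) him).mul_left
      (cexp (-Real.pi * a ^ 2 * z))).congr_fun fun n => ?_
    rw [jacobiTheta₂_term, ← Complex.exp_add]
    congr 1
    linear_combination (-2 * Real.pi * n * a * z - Real.pi * n ^ 2 * z) * I_sq
  · refine (hasSum_jacobiTheta₂_term (a : ℂ) him).congr_fun fun n => ?_
    rw [jacobiTheta₂_term]
    congr 1
    linear_combination (- Real.pi * n ^ 2 * z) * I_sq

lemma auxTh_norm_sub_one (a : ℝ) {z : ℂ} (hz : 0 < z.re) :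
    ‖auxTh a z - 1‖ ≤ HurwitzZeta.evenKernel a z.re + (HurwitzZeta.evenKernel 0 z.re - 1) := by
  have him : 0 < (I * z).im := by simpa using hz
  have h1 : HasSum (fun n : ℤ => cexp (-Real.pi * z * (n + a) ^ 2))
      (cexp (-Real.pi * a ^ 2 * z) * jacobiTheta₂ (a * I * z) (I * z)) := by
    refine ((hasSum_jacobiTheta₂_term (a * I * z) him).mul_left
      (cexp (-Real.pi * a ^ 2 * z))).congr_fun fun n => ?_
    rw [jacobiTheta₂_term, ← Complex.exp_add]
    congr 1
    linear_combination (-2 * Real.pi * n * a * z - Real.pi * n ^ 2 * z) * I_sq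
  have h2 : HasSum (fun n : ℤ => cexp (-Real.pi * z * n ^ 2 + 2 * Real.pi * I * n * a))
      (jacobiTheta₂ a (I * z)) := by
    refine (hasSum_jacobiTheta₂_term (a : ℂ) him).congr_fun fun n => ?_
    rw [jacobiTheta₂_term]
    congr 1
    linear_combination (- Real.pi * n ^ 2 * z) * I_sq
  have h3 := hasSum_ite_sub_hasSum h2 0
  have h4 := HurwitzZeta.hasSum_int_evenKernel a hz
  have h5 := HurwitzZeta.hasSum_int_evenKernel₀ 0 hz
  have h6 := (h4.add h5)
  have h7 := h1.add h3
  have e : auxTh a z - 1 = cexp (-Real.pi * a ^ 2 * z) * jacobiTheta₂ (a * I * z) (I * z) +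
      (jacobiTheta₂ a (I * z) - cexp (-Real.pi * z * (0 : ℤ) ^ 2 + 2 * Real.pi * I * (0 : ℤ) * a)) := by
    simp [auxTh]; ring
  rw [e]
  have e' : HurwitzZeta.evenKernel a z.re + (HurwitzZeta.evenKernel 0 z.re - 1) =
    HurwitzZeta.evenKernel a z.re + (HurwitzZeta.evenKernel (0 : ℝ) z.re - 
      (if ((0 : ℝ) : UnitAddCircle) = 0 then 1 else 0)) := by simp
  rw [e']
  refine HasSum.norm_le_of_bounded h7 h6 fun n => ?_
  refine (norm_add_le _ _).trans (add_le_add ?_ ?_)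
  · rw [Complex.norm_exp]
    apply le_of_eq; congr 1
    have : -(Real.pi : ℂ) * z * (n + a) ^ 2 = ((-Real.pi * (n + a) ^ 2 : ℝ) : ℂ) * z := by
      push_cast; ring
    rw [this, re_ofReal_mul]
  · by_cases hn : n = 0
    · simp [hn]
    · rw [if_neg hn, if_neg (by simpa using hn), Complex.norm_exp]
      apply le_of_eq; congr 1
      have : -(Real.pi : ℂ) * z * n ^ 2 + 2 * Real.pi * I * n * a
        = ((-Real.pi * n ^ 2 : ℝ) : ℂ) * z + ((2 * Real.pi * n * a : ℝ) : ℂ) * I := by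
        push_cast; ring
      rw [this, add_re, re_ofReal_mul, re_ofReal_mul]
      simp

lemma auxTh_feq (a : ℝ) {z : ℂ} (hz : 0 < z.re) : auxTh a (1 / z) = z ^ (1 / 2 : ℂ) * auxTh a z := by
  have hz0 : z ≠ 0 := by rintro rfl; simp at hz
  have key : ∀ w : ℂ, w ≠ 0 → jacobiTheta₂ a (I * w) = 1 / w ^ (1 / 2 : ℂ) *
      (cexp (-Real.pi * a ^ 2 * (1 / w)) * jacobiTheta₂ (a * I * (1 / w)) (I * (1 / w))) := by
    intro w hw
    rw [jacobiTheta₂_functional_equation]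
    have e1 : -I * (I * w) = w := by linear_combination (-w) * I_sq
    have e2 : (a : ℂ) / (I * w) = -(a * I * (1 / w)) := by
      field_simp; simp
    have e3 : -1 / (I * w) = I * (1 / w) := by
      field_simp; simp
    have e4 : -(Real.pi : ℂ) * I * a ^ 2 / (I * w) = -Real.pi * a ^ 2 * (1 / w) := by
      field_simp
    rw [e1, e2, e3, e4, jacobiTheta₂_neg_left, mul_assoc]
  have harg : z.arg ≠ Real.pi := by
    intro h
    rw [arg_eq_pi_iff] at h
    linarith [h.1]
  have hp : z ^ (1 / 2 : ℂ) ≠ 0 := by simp [cpow_eq_zero_iff, hz0]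
  have k1 := key z hz0
  have k2 := key (1 / z) (by simpa using hz0)
  rw [one_div_one_div] at k2
  have : (1 / z) ^ (1 / 2 : ℂ) = (z ^ (1 / 2 : ℂ))⁻¹ := by
    rw [one_div z, inv_cpow _ _ harg]
  rw [this] at k2
  unfold auxTh
  rw [k2, k1]
  field_simp
  ring

lemma auxTh_continuousAt (a : ℝ) {z : ℂ} (hz : 0 < z.re) : ContinuousAt (auxTh a) z := by
  have him : 0 < (I * z).im := by simpa using hz
  unfold auxTh
  apply ContinuousAt.add
  · apply ContinuousAt.mul (by fun_prop)
    exact (continuousAt_jacobiTheta₂ (a * I * z) him).comp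
      (f := fun z : ℂ => (a * I * z, I * z)) (by fun_prop)
  · exact (continuousAt_jacobiTheta₂ (a : ℂ) him).comp
      (f := fun z : ℂ => ((a : ℂ), I * z)) (by fun_prop)
    
lemma auxTh_isBigO (a : ℝ) (ha : 0 < a) (ha' : a < 1) {z : ℂ} (hz : 0 < z.re) (r : ℝ) :
    (fun t : ℝ => auxTh a (z * t) - 1) =O[Filter.atTop] (fun t : ℝ => t ^ r) := by
  have ha0 : (a : UnitAddCircle) ≠ 0 := by
    rw [Ne, AddCircle.coe_eq_zero_iff]
    rintro ⟨n, hn⟩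
    simp at hn
    have h1 : (0 : ℝ) < n := by rw [hn]; exact ha
    have h2 : (n : ℝ) < 1 := by rw [hn]; exact ha'
    have h3 : (0 : ℤ) < n := by exact_mod_cast h1
    have h4 : n < (1 : ℤ) := by exact_mod_cast h2
    omega
  have gen : ∀ b : UnitAddCircle, (fun t : ℝ => HurwitzZeta.evenKernel b (z.re * t) -
      (if b = 0 then 1 else 0)) =O[Filter.atTop] (fun t : ℝ => t ^ r) := by
    intro b
    obtain ⟨p, hp, h⟩ := HurwitzZeta.isBigO_atTop_evenKernel_sub b
    have h' := h.comp_tendsto (Filter.tendsto_id.const_mul_atTop hz)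
    refine h'.trans ?_
    have := (isLittleO_exp_neg_mul_rpow_atTop (mul_pos hp hz) r).isBigO
    refine this.congr_left fun t => ?_
    simp [mul_assoc]
  have h1 := gen a
  have h2 := gen 0
  simp only [if_neg ha0, sub_zero] at h1
  simp only [if_true] at h2
  refine Asymptotics.IsBigO.trans (Asymptotics.IsBigO.of_bound 1 ?_) (h1.add h2)
  filter_upwards [Filter.eventually_gt_atTop 0] with t ht
  have hre : (z * t).re = z.re * t := by simp
  have := auxTh_norm_sub_one a (z := z * t) (by rw [hre]; positivity)
  rw [hre] at this
  rw [one_mul]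
  exact this.trans (le_abs_self _)

lemma aux_sq_cpow {x : ℂ} (hx : 0 < x.re) : (x ^ 2) ^ (1 / 2 : ℂ) = x := by
  have := Complex.sq_cpow_two_inv (x := x) hx
  rw [one_div]; exact this

lemma aux_inv_sq_re {x : ℂ} (hx2 : 0 < (x ^ 2).re) : 0 < ((x⁻¹) ^ 2).re := by
  rw [inv_pow, inv_re]
  have : x ^ 2 ≠ 0 := by intro h; simp [h] at hx2
  exact div_pos hx2 (normSq_pos.mpr this)

lemma auxTh_locInt (a : ℝ) {z : ℂ} (hz : 0 < z.re) :
    ContinuousOn (fun t : ℝ => auxTh a (z * t)) (Set.Ioi 0) := by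
  intro t ht
  have ht' : 0 < t := ht
  apply ContinuousAt.continuousWithinAt
  have hre : (z * t).re = z.re * t := by simp
  exact (auxTh_continuousAt a (z := z * t) (by rw [hre]; positivity)).comp
    (f := fun t : ℝ => z * t) (by fun_prop)

/-- FE pair -/
noncomputable def auxP (a : ℝ) (ha : 0 < a) (ha' : a < 1) (x : ℂ) (hx : 0 < x.re)
    (hx2 : 0 < (x ^ 2).re) : WeakFEPair ℂ where
  f := fun t => auxTh a (x ^ 2 * t)
  g := fun t => auxTh a ((x⁻¹) ^ 2 * t)
  k := 1 / 2
  ε := x⁻¹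
  f₀ := 1
  g₀ := 1
  hk := by norm_num
  hε := by
    have : x ≠ 0 := by intro h; simp [h] at hx
    simpa using this
  hf_int := (auxTh_locInt a hx2).locallyIntegrableOn measurableSet_Ioi
  hg_int := (auxTh_locInt a (aux_inv_sq_re hx2)).locallyIntegrableOn measurableSet_Ioi
  hf_top := auxTh_isBigO a ha ha' hx2
  hg_top := auxTh_isBigO a ha ha' (aux_inv_sq_re hx2)
  h_feq := by
    intro t ht
    replace ht : 0 < t := ht
    have hxne : x ≠ 0 := by intro h; simp [h] at hx
    have e : x ^ 2 * ((1 / t : ℝ) : ℂ) = 1 / ((x⁻¹) ^ 2 * t) := by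
      push_cast; field_simp
    have hxi : 0 < (x⁻¹).re := by
      rw [inv_re]
      exact div_pos hx (normSq_pos.mpr hxne)
    have h2 := aux_inv_sq_re hx2
    have hre : ((x⁻¹) ^ 2 * (t : ℂ)).re = ((x⁻¹) ^ 2).re * t := by simp
    rw [e, auxTh_feq a (by rw [hre]; positivity), mul_comm ((x⁻¹) ^ 2) (t : ℂ),
      aux_ofReal_mul_cpow ht (pow_ne_zero 2 (inv_ne_zero hxne)), aux_sq_cpow hxi, smul_eq_mul,
      ofReal_cpow ht.le]
    push_cast
    ring

lemma aux_sq_cpow_neg {x : ℂ} (hx : 0 < x.re) (s : ℂ) : (x ^ 2) ^ (-s) = x ^ (-(2 * s)) := by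
  have h := abs_arg_lt_pi_div_two_iff.mpr (Or.inl hx)
  have h' := abs_lt.mp h
  have hx0 : x ≠ 0 := by intro h; simp [h] at hx
  have : x ^ 2 = x ^ ((2 : ℕ) : ℂ) := by rw [cpow_natCast]
  rw [this, ← cpow_mul]
  · congr 1; push_cast; ring
  · simp [Complex.log_im]; linarith
  · simp [Complex.log_im]; linarith

lemma aux_sq_pi_re {x : ℂ} {q : ℝ} :
    ((Real.pi : ℂ) * (q : ℂ) ^ 2 * x ^ 2).re = Real.pi * q ^ 2 * (x ^ 2).re := by
  have : (Real.pi : ℂ) * (q : ℂ) ^ 2 * x ^ 2 = ((Real.pi * q ^ 2 : ℝ) : ℂ) * x ^ 2 := by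
    push_cast; ring
  rw [this, re_ofReal_mul]

lemma aux_term {x : ℂ} (hx : 0 < x.re) (hx2 : 0 < (x ^ 2).re) {q : ℝ} (hq : q ≠ 0) {s : ℂ}
    (hs : 0 < s.re) :
    ∫ t in Set.Ioi (0 : ℝ), (t : ℂ) ^ (s - 1) * cexp (-((Real.pi * q ^ 2 * x ^ 2) * t)) =
      x ^ (-(2 * s)) * (Gammaℝ (2 * s) / ((|q| : ℝ) : ℂ) ^ (2 * s)) := by
  have hq2 : 0 < Real.pi * q ^ 2 := by positivity
  have hx0 : x ≠ 0 := by intro h; simp [h] at hx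
  have hq' : 0 < |q| := abs_pos.mpr hq
  rw [aux_gamma_complex hs (by rw [aux_sq_pi_re]; positivity)]
  have e : (Real.pi : ℂ) * (q : ℂ) ^ 2 * x ^ 2 = ((Real.pi * q ^ 2 : ℝ) : ℂ) * x ^ 2 := by
    push_cast; ring
  have e2 : ((Real.pi * q ^ 2 : ℝ) : ℂ) = ((Real.pi : ℝ) : ℂ) * ((|q| : ℝ) : ℂ) ^ 2 := by
    rw [← sq_abs q]; push_cast; ring
  have hq0 : ((|q| : ℝ) : ℂ) ≠ 0 := by exact_mod_cast hq'.ne'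
  rw [e, aux_ofReal_mul_cpow hq2 (pow_ne_zero 2 hx0), aux_sq_cpow_neg hx, e2,
    aux_ofReal_mul_cpow Real.pi_pos (pow_ne_zero 2 hq0), aux_sq_cpow_neg (by simpa using hq),
    Gammaℝ_def, show -(2 * s) / 2 = -s by ring, show 2 * s / 2 = s by ring,
    cpow_neg ((|q| : ℝ) : ℂ)]
  ring

lemma aux_term_norm {x : ℂ} (hx2 : 0 < (x ^ 2).re) {q : ℝ} (hq : q ≠ 0) {s : ℂ}
    (hs : 0 < s.re) :
    ∫ t in Set.Ioi (0 : ℝ), ‖(t : ℂ) ^ (s - 1) * cexp (-((Real.pi * q ^ 2 * x ^ 2) * t))‖ =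
      ((Real.pi * (x ^ 2).re) ^ (-s.re) * Real.Gamma s.re) * (1 / |q| ^ (2 * s.re)) := by
  have hq2 : 0 < Real.pi * q ^ 2 * (x ^ 2).re := by positivity
  rw [setIntegral_congr_fun measurableSet_Ioi (fun t ht => aux_norm_term ht), aux_sq_pi_re]
  have := Real.integral_rpow_mul_exp_neg_mul_Ioi hs hq2
  simp only [neg_mul] at this ⊢
  rw [this, one_div, ← Real.rpow_neg_eq_inv_rpow,
    show Real.pi * q ^ 2 * (x ^ 2).re = (Real.pi * (x ^ 2).re) * |q| ^ 2 by rw [sq_abs]; ring,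
    Real.mul_rpow (by positivity) (by positivity), ← Real.rpow_natCast |q| 2,
    ← Real.rpow_mul (abs_nonneg q)]
  rw [show ((2 : ℕ) : ℝ) * -s.re = -(2 * s.re) by push_cast; ring, Real.rpow_neg (abs_nonneg q)]
  ring

lemma aux_Lambda_eq (a : ℝ) (ha : 0 < a) (ha' : a < 1) (x : ℂ) (hx : 0 < x.re)
    (hx2 : 0 < (x ^ 2).re) {s : ℂ} (hs : 1 / 2 < s.re) :
    (auxP a ha ha' x hx hx2).Λ s = 2 * x ^ (-(2 * s)) *
      (HurwitzZeta.completedHurwitzZetaEven a (2 * s) + HurwitzZeta.completedCosZeta a (2 * s)) := by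
  have hs0 : 0 < s.re := by linarith
  have hs2 : 1 < (2 * s).re := by simp; linarith
  rw [← ((auxP a ha ha' x hx hx2).hasMellin (s := s) hs).2]
  have hna : ∀ n : ℤ, (n : ℝ) + a ≠ 0 := by
    intro n h
    have h1 : (-1 : ℝ) < n := by linarith
    have h2 : (n : ℝ) < 0 := by linarith
    have h3 : (-1 : ℤ) < n := by exact_mod_cast h1
    have h4 : n < (0 : ℤ) := by exact_mod_cast h2
    omega
  let c : ℤ → ℂ := fun n => if n = 0 then 0 else cexp (2 * Real.pi * I * a * n)
  let A : ℤ → ℝ → ℂ := fun n t => (t : ℂ) ^ (s - 1) *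
    cexp (-((Real.pi * ((n + a : ℝ) : ℂ) ^ 2 * x ^ 2) * t))
  let B : ℤ → ℝ → ℂ := fun n t => c n * ((t : ℂ) ^ (s - 1) *
    cexp (-((Real.pi * ((n : ℝ) : ℂ) ^ 2 * x ^ 2) * t)))
  have hA : ∀ n, IntegrableOn (A n) (Set.Ioi 0) := fun n =>
    aux_integrable_term hs0 (by
      rw [aux_sq_pi_re]; have := hna n; positivity)
  have hB : ∀ n, IntegrableOn (B n) (Set.Ioi 0) := by
    intro n
    by_cases hn : n = 0
    · simp [B, c, hn]
    · refine Integrable.const_mul (aux_integrable_term hs0 ?_) _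
      rw [aux_sq_pi_re]
      have : (n : ℝ) ≠ 0 := by exact_mod_cast hn
      positivity
  have hc : ∀ n, ‖c n‖ ≤ 1 := by
    intro n
    by_cases hn : n = 0
    · simp [c, hn]
    · simp only [c, if_neg hn]
      rw [show 2 * (Real.pi : ℂ) * I * a * n = ((2 * Real.pi * a * n : ℝ) : ℂ) * I by push_cast; ring,
        norm_exp_ofReal_mul_I]
  set K : ℝ := (Real.pi * (x ^ 2).re) ^ (-s.re) * Real.Gamma s.re with hK
  have hKpos : 0 ≤ K := by
    have := Real.Gamma_pos_of_pos hs0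
    positivity
  have hnA : ∀ n, ∫ t in Set.Ioi (0 : ℝ), ‖A n t‖ = K * (1 / |(n : ℝ) + a| ^ (2 * s.re)) := by
    intro n
    exact aux_term_norm hx2 (hna n) hs0
  have hnB : ∀ n, ∫ t in Set.Ioi (0 : ℝ), ‖B n t‖ ≤ K * (1 / |(n : ℝ) + 0| ^ (2 * s.re)) := by
    intro n
    by_cases hn : n = 0
    · simp only [B, c, hn, if_true, zero_mul, norm_zero, integral_zero]
      positivity
    · have hn' : (n : ℝ) ≠ 0 := by exact_mod_cast hn
      rw [add_zero, ← aux_term_norm hx2 hn' hs0]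
      simp only [B, norm_mul (c n)]
      rw [integral_const_mul]
      refine (mul_le_mul_of_nonneg_right (hc n) ?_).trans (one_mul _).le
      exact integral_nonneg fun _ => norm_nonneg _
  have hsum : Summable fun n => ∫ t in Set.Ioi (0 : ℝ), ‖A n t + B n t‖ := by
    have S1 := ((Real.summable_one_div_int_add_rpow a (2 * s.re)).mpr (by linarith)).mul_left K
    have S2 := ((Real.summable_one_div_int_add_rpow 0 (2 * s.re)).mpr (by linarith)).mul_left K
    refine Summable.of_nonneg_of_le (fun n => integral_nonneg fun _ => norm_nonneg _) (fun n => ?_)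
      (S1.add S2)
    calc ∫ t in Set.Ioi (0 : ℝ), ‖A n t + B n t‖
        ≤ ∫ t in Set.Ioi (0 : ℝ), (‖A n t‖ + ‖B n t‖) :=
          integral_mono ((hA n).add (hB n)).norm ((hA n).norm.add (hB n).norm)
            (fun t => norm_add_le _ _)
      _ = (∫ t in Set.Ioi (0 : ℝ), ‖A n t‖) + ∫ t in Set.Ioi (0 : ℝ), ‖B n t‖ :=
          integral_add (hA n).norm (hB n).norm
      _ ≤ _ := add_le_add (hnA n).le (hnB n)
  have H := hasSum_integral_of_summable_integral_norm (μ := volume.restrict (Set.Ioi (0 : ℝ)))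
    (F := fun n t => A n t + B n t) (fun n => (hA n).add (hB n)) hsum
  have e1 : ∫ t in Set.Ioi (0 : ℝ), ∑' n, (A n t + B n t) =
      mellin (fun t => (auxP a ha ha' x hx hx2).f t - (auxP a ha ha' x hx hx2).f₀) s := by
    rw [mellin]
    refine setIntegral_congr_fun measurableSet_Ioi fun t ht => ?_
    have ht' : 0 < t := ht
    have hre : (x ^ 2 * (t : ℂ)).re = (x ^ 2).re * t := by simp
    have T := auxTh_hasSum a (z := x ^ 2 * t) (by rw [hre]; positivity)
    have T' := (T.sub (hasSum_ite_eq (0 : ℤ) (1 : ℂ))).mul_left ((t : ℂ) ^ (s - 1))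
    change _ = (t : ℂ) ^ (s - 1) • (auxTh a (x ^ 2 * t) - 1)
    rw [smul_eq_mul, ← T'.tsum_eq]
    refine tsum_congr fun n => ?_
    simp only [A, B, c]
    by_cases hn : n = 0
    · simp only [hn, if_true]
      push_cast
      simp
      left
      ring_nf
    · simp only [hn, if_false, sub_zero]
      rw [mul_left_comm, ← mul_add, ← Complex.exp_add]
      push_cast
      ring_nf
  rw [← e1]
  have C1 := HurwitzZeta.hasSum_int_completedHurwitzZetaEven a hs2
  have C2 := HurwitzZeta.hasSum_int_completedCosZeta a hs2
  have C3 := (C1.add C2).mul_left (2 * x ^ (-(2 * s)))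
  refine H.unique (C3.congr_fun fun n => ?_)
  rw [integral_add (hA n) (hB n)]
  simp only [A, B]
  rw [aux_term hx hx2 (hna n) hs0, integral_const_mul]
  by_cases hn : n = 0
  · have : (2 * s) ≠ 0 := by
      intro h; rw [h] at hs2; simp at hs2; linarith
    simp only [hn, c, if_true, zero_mul, abs_zero, Int.cast_zero, zero_cpow this, div_zero, zero_div]
    push_cast
    ring
  · have hn' : (n : ℝ) ≠ 0 := by exact_mod_cast hn
    rw [aux_term hx hx2 hn' hs0]
    have hab : ((|(n : ℝ)| : ℝ) : ℂ) = ((|n| : ℤ) : ℂ) := by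
      rw [← Int.cast_abs]; norm_cast
    simp only [c, if_neg hn]
    rw [hab]
    ring

lemma aux_strip (P : WeakFEPair ℂ) {s : ℂ} (h0 : 0 < s.re) (h1 : s.re < P.k) :
    HasMellin (fun t : ℝ => P.f t - P.f₀ - P.ε * ((t ^ (-P.k) : ℝ) : ℂ) * P.g₀) s (P.Λ s) := by
  have hM := P.isStrongFEPair_toStrongFEPair.hasMellin s
  have hM1 : IntegrableOn (fun t : ℝ => (t : ℂ) ^ (s - 1) * P.f_modif t) (Set.Ioi 0) := hM.1
  have hI := integrableOn_Ioi_cpow_of_lt (a := s - 1 - P.k) (c := 1) (by simp; linarith) one_pos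
  have hI' := integral_Ioi_cpow_of_lt (a := s - 1 - P.k) (c := 1) (by simp; linarith) one_pos
  have hO := hasMellin_one_Ioc h0
  have hO1 : IntegrableOn (fun t : ℝ => (t : ℂ) ^ (s - 1) *
    (Set.Ioc 0 1).indicator (fun _ => (1 : ℂ)) t) (Set.Ioi 0) := hO.1
  have hO2 : ∫ t in Set.Ioi (0 : ℝ), (t : ℂ) ^ (s - 1) *
    (Set.Ioc 0 1).indicator (fun _ => (1 : ℂ)) t = 1 / s := hO.2
  set J : ℝ → ℂ := (Set.Ioi (1 : ℝ)).indicator (fun t : ℝ => (t : ℂ) ^ (s - 1 - P.k)) with hJ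
  have hJ1 : IntegrableOn J (Set.Ioi 0) := by
    rw [hJ, integrableOn_indicator_iff measurableSet_Ioi]
    exact hI.mono_set Set.inter_subset_left
  have hJ2 : ∫ t in Set.Ioi (0 : ℝ), J t = 1 / (P.k - s) := by
    rw [hJ, setIntegral_indicator measurableSet_Ioi,
      Set.inter_eq_right.mpr (Set.Ioi_subset_Ioi zero_le_one), hI']
    rw [ofReal_one, one_cpow, ← neg_div_neg_eq, neg_neg]
    congr 1; ring
  have hfun : (fun t : ℝ => (t : ℂ) ^ (s - 1) * P.f_modif t
      - ((t : ℂ) ^ (s - 1) * (Set.Ioc 0 1).indicator (fun _ => (1 : ℂ)) t) * P.f₀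
      - J t * (P.ε * P.g₀)) =ᵐ[volume.restrict (Set.Ioi 0)]
      fun t : ℝ => (t : ℂ) ^ (s - 1) • (P.f t - P.f₀ - P.ε * ((t ^ (-P.k) : ℝ) : ℂ) * P.g₀) := by
    have hne : ∀ᵐ t : ℝ ∂(volume.restrict (Set.Ioi 0)), t ≠ 1 :=
      ae_restrict_of_ae (by simp [ae_iff])
    filter_upwards [hne, ae_restrict_mem measurableSet_Ioi] with t ht1 ht
    replace ht : 0 < t := ht
    have ht0 : (t : ℂ) ≠ 0 := by exact_mod_cast ht.ne'
    simp only [WeakFEPair.f_modif, Pi.add_apply, hJ, smul_eq_mul]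
    rcases lt_or_gt_of_ne ht1 with h | h
    · rw [Set.indicator_of_notMem (by simpa using h.le), Set.indicator_of_mem (show t ∈ Set.Ioo 0 1 from ⟨ht, h⟩),
        Set.indicator_of_mem (show t ∈ Set.Ioc 0 1 from ⟨ht, h.le⟩), Set.indicator_of_notMem (by simpa using h.le)]
      simp; ring
    · rw [Set.indicator_of_mem (show t ∈ Set.Ioi 1 from h), Set.indicator_of_notMem (by simp; intro _; exact h.le),
        Set.indicator_of_notMem (by simp [h]), Set.indicator_of_mem (show t ∈ Set.Ioi 1 from h),
        ofReal_cpow ht.le, sub_eq_add_neg (s - 1) (P.k : ℂ), cpow_add _ _ ht0]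
      push_cast
      ring
  have A1 := hO1.mul_const P.f₀
  have A2 := hJ1.mul_const (P.ε * P.g₀)
  have A0 : Integrable (fun t : ℝ => (t : ℂ) ^ (s - 1) * P.f_modif t
      - ((t : ℂ) ^ (s - 1) * (Set.Ioc 0 1).indicator (fun _ => (1 : ℂ)) t) * P.f₀)
      (volume.restrict (Set.Ioi 0)) := hM1.sub A1
  constructor
  · exact (A0.sub A2).congr hfun
  · rw [mellin, ← integral_congr_ae hfun, integral_sub A0 A2, integral_sub hM1 A1,
      integral_mul_const, integral_mul_const, hO2, hJ2, WeakFEPair.Λ, WeakFEPair.Λ₀, mellin]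
    simp only [smul_eq_mul]
    ring

lemma aux_Lambda_eq_all (a : ℝ) (ha : 0 < a) (ha' : a < 1) (x : ℂ) (hx : 0 < x.re)
    (hx2 : 0 < (x ^ 2).re) {s : ℂ} (hs : s ≠ 0) (hs' : s ≠ 1 / 2) :
    (auxP a ha ha' x hx hx2).Λ s = 2 * x ^ (-(2 * s)) *
      (HurwitzZeta.completedHurwitzZetaEven a (2 * s) + HurwitzZeta.completedCosZeta a (2 * s)) := by
  have hx0 : x ≠ 0 := by intro h; simp [h] at hx
  let U : Set ℂ := ({0, 1 / 2} : Set ℂ)ᶜ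
  have hU : IsOpen U := (Set.toFinite _).isClosed.isOpen_compl
  have hc : IsPreconnected U :=
    (Set.Countable.isConnected_compl_of_one_lt_rank (by simp) (Set.toFinite _).countable).isPreconnected
  have hmem : ∀ z ∈ U, z ≠ 0 ∧ z ≠ 1 / 2 := by
    intro z hz; simpa [U, not_or] using hz
  have d1 : DifferentiableOn ℂ (auxP a ha ha' x hx hx2).Λ U := by
    intro z hz
    obtain ⟨h1, h2⟩ := hmem z hz
    refine ((auxP a ha ha' x hx hx2).differentiableAt_Λ (Or.inl h1) (Or.inl ?_)).differentiableWithinAt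
    simpa [auxP] using h2
  have d2 : DifferentiableOn ℂ (fun s : ℂ => 2 * x ^ (-(2 * s)) *
      (HurwitzZeta.completedHurwitzZetaEven a (2 * s) + HurwitzZeta.completedCosZeta a (2 * s))) U := by
    intro z hz
    obtain ⟨h1, h2⟩ := hmem z hz
    have h3 : 2 * z ≠ 0 := by simpa using h1
    have h4 : 2 * z ≠ 1 := by
      intro h; apply h2; rw [← h]; ring
    refine DifferentiableAt.differentiableWithinAt ?_
    refine DifferentiableAt.mul ?_ (DifferentiableAt.add ?_ ?_)
    · refine (DifferentiableAt.const_cpow (by fun_prop) (Or.inl hx0)).const_mul _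
    · exact (HurwitzZeta.differentiableAt_completedHurwitzZetaEven _ (Or.inl h3) h4).comp z
        (f := fun z => 2 * z) (by fun_prop)
    · exact (HurwitzZeta.differentiableAt_completedCosZeta _ h3 (Or.inl h4)).comp z
        (f := fun z => 2 * z) (by fun_prop)
  have key := (d1.analyticOnNhd hU).eqOn_of_preconnected_of_eventuallyEq (d2.analyticOnNhd hU) hc
    (z₀ := 1) (by simp [U]) (by
      have : {z : ℂ | 1 / 2 < z.re} ∈ nhds (1 : ℂ) :=
        (isOpen_lt continuous_const continuous_re).mem_nhds (by norm_num)
      filter_upwards [this] with z hz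
      exact aux_Lambda_eq a ha ha' x hx hx2 hz)
  exact key (by simpa [U, not_or] using And.intro hs (by simpa using hs'))

/-- gamma -/
noncomputable def auxg (a : ℝ) (x : ℂ) (w : ℝ) : ℂ := auxTh a (x ^ 2 * (w ^ (2 : ℝ) : ℝ)) - 1
  - x⁻¹ * (((w ^ (2 : ℝ)) ^ (-(1 / 2 : ℝ)) : ℝ) : ℂ)

lemma auxg_mellin (a : ℝ) (ha : 0 < a) (ha' : a < 1) (x : ℂ) (hx : 0 < x.re)
    (hx2 : 0 < (x ^ 2).re) {s : ℂ} (hs : 0 < s.re) (hs' : s.re < 1) :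
    HasMellin (auxg a x) s (x ^ (-s) *
      (HurwitzZeta.completedHurwitzZetaEven a s + HurwitzZeta.completedCosZeta a s)) := by
  have h := aux_strip (auxP a ha ha' x hx hx2) (s := s / 2) (by simpa using hs)
    (by simp [auxP]; linarith)
  obtain ⟨φ, hφ⟩ : ∃ φ : ℝ → ℂ, φ = fun t : ℝ => (auxP a ha ha' x hx hx2).f t -
    (auxP a ha ha' x hx hx2).f₀ - (auxP a ha ha' x hx hx2).ε *
      ((t ^ (-(auxP a ha ha' x hx hx2).k) : ℝ) : ℂ) * (auxP a ha ha' x hx hx2).g₀ := ⟨_, rfl⟩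
  rw [← hφ] at h
  have e : (fun w : ℝ => φ (w ^ (2 : ℝ))) = auxg a x := by
    ext w
    simp [hφ, auxP, auxg]
  rw [aux_Lambda_eq_all a ha ha' x hx hx2 (by rintro h; simp at h; simp [h] at hs)
    (by intro h
        have : s = 1 := by linear_combination 2 * h
        simp [this] at hs')] at h
  have e2 : s / ((2 : ℝ) : ℂ) = s / 2 := by push_cast; rfl
  constructor
  · rw [← e, MellinConvergent.comp_rpow two_ne_zero, e2]
    exact h.1
  · rw [← e, mellin_comp_rpow, e2, h.2, show 2 * (s / 2) = s by ring]
    simp [real_smul]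
    ring

lemma auxg_eq (a : ℝ) (x : ℂ) {w : ℝ} (hw : 0 < w) :
    auxg a x w = auxTh a ((x * w) ^ 2) - 1 - 1 / (x * w) := by
  have : (w ^ (2 : ℝ)) ^ (-(1 / 2 : ℝ)) = w⁻¹ := by
    rw [← Real.rpow_mul hw.le]; norm_num [Real.rpow_neg_one]
  rw [auxg, this, Real.rpow_two]
  push_cast
  rw [mul_pow, one_div, mul_inv]

lemma aux_exp_neg_deriv :
    ∀ y ∈ (Set.univ : Set ℝ), HasDerivWithinAt (Real.exp ∘ Neg.neg) (-Real.exp (-y)) Set.univ y :=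
  fun y _ => mul_neg_one (Real.exp (-y)) ▸
    ((Real.hasDerivAt_exp (-y)).comp y (hasDerivAt_neg y)).hasDerivWithinAt

lemma aux_exp_neg_image : Real.exp ∘ Neg.neg '' Set.univ = Set.Ioi 0 := by
  rw [Set.image_comp, Set.image_univ_of_surjective neg_surjective, Set.image_univ, Real.range_exp]

lemma aux_exp_neg_injOn : Set.univ.InjOn (Real.exp ∘ Neg.neg) :=
  Real.exp_injective.injOn.comp neg_injective.injOn (Set.univ.mapsTo_univ _)

lemma aux_cov_integrable {E : Type*} [NormedAddCommGroup E] [NormedSpace ℝ E] (f : ℝ → E) :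
    IntegrableOn f (Set.Ioi 0) ↔ Integrable fun y : ℝ => Real.exp (-y) • f (Real.exp (-y)) := by
  rw [← aux_exp_neg_image, integrableOn_image_iff_integrableOn_abs_deriv_smul
    MeasurableSet.univ aux_exp_neg_deriv aux_exp_neg_injOn]
  simp

lemma aux_cov_integral {E : Type*} [NormedAddCommGroup E] [NormedSpace ℝ E] (f : ℝ → E) :
    ∫ w in Set.Ioi (0 : ℝ), f w = ∫ y : ℝ, Real.exp (-y) • f (Real.exp (-y)) := by
  rw [← aux_exp_neg_image, integral_image_eq_integral_abs_deriv_smul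
    MeasurableSet.univ aux_exp_neg_deriv aux_exp_neg_injOn]
  simp

/-- h -/
noncomputable def auxh (a : ℝ) (x : ℂ) (y : ℝ) : ℂ :=
  Real.exp (-(1 / 2) * y) • auxg a x (Real.exp (-y))

lemma auxg_cont (a : ℝ) {x : ℂ} (hx2 : 0 < (x ^ 2).re) : ContinuousOn (auxg a x) (Set.Ioi 0) := by
  have h1 : ContinuousOn (fun w : ℝ => auxTh a (x ^ 2 * (w ^ (2 : ℝ) : ℝ))) (Set.Ioi 0) := by
    refine (auxTh_locInt a hx2).comp (f := fun w : ℝ => w ^ (2 : ℝ)) ?_ ?_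
    · exact (Real.continuous_rpow_const (by norm_num)).continuousOn
    · intro w hw
      exact Real.rpow_pos_of_pos hw _
  refine (h1.sub continuousOn_const).sub (continuousOn_const.mul ?_)
  intro w hw
  have hw' : 0 < w := hw
  refine ContinuousAt.continuousWithinAt (continuous_ofReal.continuousAt.comp
    (f := fun w : ℝ => (w ^ (2 : ℝ)) ^ (-(1 / 2 : ℝ))) ?_)
  refine ContinuousAt.rpow_const ?_ (Or.inl (Real.rpow_pos_of_pos hw' _).ne')
  exact (Real.continuous_rpow_const (by norm_num)).continuousAt

lemma auxg_sq_integrable (a : ℝ) (ha : 0 < a) (ha' : a < 1) (x : ℂ) (hx : 0 < x.re)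
    (hx2 : 0 < (x ^ 2).re) : IntegrableOn (fun w => ‖auxg a x w‖ ^ 2) (Set.Ioi 0) := by
  let P := auxP a ha ha' x hx hx2
  have hpow : ∀ w : ℝ, 0 < w → (w ^ (2 : ℝ)) ^ (-(1 / 2 : ℝ)) = w ^ (-1 : ℝ) := by
    intro w hw
    rw [← Real.rpow_mul hw.le]; norm_num
  have top : (auxg a x) =O[Filter.atTop] (fun w : ℝ => w ^ (-1 : ℝ)) := by
    have h1 := (auxTh_isBigO a ha ha' hx2 (-(1 / 2))).comp_tendsto
      (tendsto_rpow_atTop (y := 2) (by norm_num))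
    have h2 : (fun w : ℝ => x⁻¹ * (((w ^ (2 : ℝ)) ^ (-(1 / 2 : ℝ)) : ℝ) : ℂ)) =O[Filter.atTop]
        (fun w : ℝ => (w ^ (2 : ℝ)) ^ (-(1 / 2 : ℝ))) := by
      refine Asymptotics.IsBigO.const_mul_left ?_ _
      exact Asymptotics.IsBigO.of_bound 1 (by simp)
    refine (h1.sub h2).congr' (Filter.Eventually.of_forall fun w => rfl) ?_
    filter_upwards [Filter.eventually_gt_atTop 0] with w hw
    exact hpow w hw
  have bot : (auxg a x) =O[nhdsWithin 0 (Set.Ioi 0)] (fun w : ℝ => (1 : ℝ)) := by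
    have hz := P.hf_zero 0
    have ht : Filter.Tendsto (fun w : ℝ => w ^ (2 : ℝ)) (nhdsWithin 0 (Set.Ioi 0))
        (nhdsWithin 0 (Set.Ioi 0)) := by
      refine tendsto_nhdsWithin_iff.mpr ⟨?_, ?_⟩
      · have := (Real.continuous_rpow_const (q := 2) (by norm_num)).tendsto 0
        rw [Real.zero_rpow (by norm_num)] at this
        exact this.mono_left nhdsWithin_le_nhds
      · filter_upwards [self_mem_nhdsWithin] with w hw
        exact Real.rpow_pos_of_pos hw _
    have h1 := hz.comp_tendsto ht
    have h2 : (fun w : ℝ => (1 : ℂ)) =O[nhdsWithin 0 (Set.Ioi 0)] (fun w : ℝ => (1 : ℝ)) :=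
      Asymptotics.isBigO_of_le _ (by simp)
    have h1' := h1.congr_right (g₂ := fun w : ℝ => (1 : ℝ)) (fun w => by simp)
    refine (h1'.sub h2).congr_left fun w => ?_
    simp [P, auxP, auxg]
    ring
  have key := mellin_convergent_of_isBigO_scalar (a := 2) (b := 0) (s := 1)
    (f := fun w => ‖auxg a x w‖ ^ 2)
    (((auxg_cont a hx2).norm.pow 2).locallyIntegrableOn measurableSet_Ioi)
    (by
      refine (top.norm_left.pow 2).congr' (Filter.Eventually.of_forall fun w => rfl) ?_
      filter_upwards [Filter.eventually_gt_atTop 0] with w hw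
      rw [← Real.rpow_natCast, ← Real.rpow_mul hw.le]; norm_num) (by norm_num)
    (by
      refine (bot.norm_left.pow 2).congr_right fun w => ?_
      simp) (by norm_num)
  simpa using key

lemma auxh_sq (a : ℝ) (x : ℂ) (y : ℝ) :
    ‖auxh a x y‖ ^ 2 = Real.exp (-y) * ‖auxg a x (Real.exp (-y))‖ ^ 2 := by
  rw [auxh, norm_smul, mul_pow, Real.norm_of_nonneg (Real.exp_pos _).le, sq (Real.exp _),
    ← Real.exp_add]
  congr 2; ring

lemma auxh_cont (a : ℝ) {x : ℂ} (hx2 : 0 < (x ^ 2).re) : Continuous (auxh a x) := by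
  have h1 : Continuous fun y : ℝ => Real.exp (-(1 / 2) * y) := by fun_prop
  refine h1.smul ?_
  exact (auxg_cont a hx2).comp_continuous (f := fun y : ℝ => Real.exp (-y)) (by fun_prop)
    (fun y => Real.exp_pos _)

lemma auxh_sq_integrable (a : ℝ) (ha : 0 < a) (ha' : a < 1) (x : ℂ) (hx : 0 < x.re)
    (hx2 : 0 < (x ^ 2).re) : Integrable (fun y => ‖auxh a x y‖ ^ 2) := by
  have := (aux_cov_integrable _).mp (auxg_sq_integrable a ha ha' x hx hx2)
  simpa only [auxh_sq, smul_eq_mul] using this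

lemma auxh_integrable (a : ℝ) (ha : 0 < a) (ha' : a < 1) (x : ℂ) (hx : 0 < x.re)
    (hx2 : 0 < (x ^ 2).re) : Integrable (auxh a x) := by
  have h := (auxg_mellin a ha ha' x hx hx2 (s := ((1 / 2 : ℝ) : ℂ)) (by simp) (by norm_num)).1
  have h' := (aux_cov_integrable _).mp h
  refine h'.congr (Filter.Eventually.of_forall fun y => ?_)
  simp only [auxh]
  rw [show (((1 / 2 : ℝ) : ℂ) - 1) = ((-(1 / 2) : ℝ) : ℂ) by push_cast; ring,
    ← ofReal_cpow (Real.exp_pos _).le, ← Real.exp_mul, coe_smul, smul_smul, ← Real.exp_add]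
  congr 2; ring

open scoped FourierTransform in
lemma aux_fubini {h : ℝ → ℂ} (hi : Integrable h) {k : ℝ} (hk : 0 < k) (t : ℝ) :
    ∫ u in (-k)..k, 𝓕 h (-(t + u) / (2 * Real.pi)) =
      𝓕 (fun y : ℝ => ((2 * (Real.sin (k * y) / y) : ℝ) : ℂ) * h y) (-t / (2 * Real.pi)) := by
  have hF : ∀ (g : ℝ → ℂ) (r : ℝ), 𝓕 g (-r / (2 * Real.pi)) = ∫ y : ℝ, cexp (((r * y : ℝ) : ℂ) * I) * g y := by
    intro g r
    rw [Real.fourier_real_eq_integral_exp_smul]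
    refine integral_congr_ae (Filter.Eventually.of_forall fun y => ?_)
    simp only [smul_eq_mul]
    congr 3
    have := Real.pi_ne_zero
    congr 1
    field_simp
  simp only [hF]
  rw [intervalIntegral.integral_of_le (by linarith), integral_integral_swap]
  · refine integral_congr_ae ?_
    have hne : ∀ᵐ y : ℝ, y ≠ 0 := by simp [ae_iff]
    filter_upwards [hne] with y hy
    rw [← intervalIntegral.integral_of_le (by linarith), intervalIntegral.integral_mul_const, ← mul_assoc]
    congr 1
    have hy' : (y : ℂ) ≠ 0 := by exact_mod_cast hy
    have e : ∀ u : ℝ, cexp ((((t + u) * y : ℝ) : ℂ) * I) = cexp (((t * y : ℝ) : ℂ) * I) * cexp ((y * I) * u) := by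
      intro u
      rw [← Complex.exp_add]; congr 1; push_cast; ring
    simp only [e]
    rw [intervalIntegral.integral_const_mul, integral_exp_mul_complex (mul_ne_zero hy' I_ne_zero)]
    congr 1
    push_cast
    rw [Complex.sin]
    field_simp
    simp only [I_sq]
    ring_nf
  · have hb : Integrable (fun p : ℝ × ℝ => (1 : ℝ) * ‖h p.2‖)
        ((volume.restrict (Set.Ioc (-k) k)).prod volume) :=
      Integrable.mul_prod (f := fun _ : ℝ => (1 : ℝ)) (integrable_const _) hi.norm
    refine hb.mono' ?_ ?_
    · refine AEStronglyMeasurable.mul ?_ (hi.aestronglyMeasurable.comp_snd)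
      exact Continuous.aestronglyMeasurable (by fun_prop)
    · refine Filter.Eventually.of_forall fun p => ?_
      simp only [Function.uncurry, norm_mul, norm_exp_ofReal_mul_I]
      exact le_rfl

lemma aux_gammaR_Q (a : ℝ) {v : ℂ} (hv : 0 < v.re) :
    (Real.pi : ℂ) ^ (-v / 2) * Complex.Gamma (v / 2) * Qzeta v a =
      HurwitzZeta.completedHurwitzZetaEven a v + HurwitzZeta.completedCosZeta a v := by
  have hG : Gammaℝ v ≠ 0 := Gammaℝ_ne_zero_of_re_pos hv
  have hv0 : v ≠ 0 := by rintro rfl; simp at hv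
  have hneg : ((1 - a : ℝ) : UnitAddCircle) = -(a : UnitAddCircle) := by
    have : ((1 : ℝ) : UnitAddCircle) = 0 := AddCircle.coe_period 1
    rw [AddCircle.coe_sub, this, zero_sub]
  have hQ : Qzeta v a = HurwitzZeta.hurwitzZetaEven a v + HurwitzZeta.cosZeta a v := by
    simp only [Qzeta, hzeta, pzeta, HurwitzZeta.hurwitzZeta, HurwitzZeta.expZeta, hneg,
      HurwitzZeta.hurwitzZetaEven_neg, HurwitzZeta.hurwitzZetaOdd_neg, HurwitzZeta.cosZeta_neg,
      HurwitzZeta.sinZeta_neg]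
    ring
  have hc : HurwitzZeta.cosZeta a v = HurwitzZeta.completedCosZeta a v / Gammaℝ v := by
    rw [HurwitzZeta.cosZeta, Function.update_of_ne hv0]
  rw [hQ, HurwitzZeta.hurwitzZetaEven_def_of_ne_or_ne (Or.inr hv0), hc, ← Gammaℝ_def]
  field_simp

open scoped FourierTransform in
lemma aux_integrand (a : ℝ) (ha : 0 < a) (ha' : a < 1) (x : ℂ) (hx : 0 < x.re)
    (hx2 : 0 < (x ^ 2).re) (t u : ℝ) :
    (Real.pi : ℂ) ^ (-(1 / 2 + I * t + I * u) / 2) * Complex.Gamma ((1 / 2 + I * t + I * u) / 2) *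
        Qzeta (1 / 2 + I * t + I * u) a * x ^ (1 / 2 + I * t + I * u - 1) =
      𝓕 (auxh a x) (-(t + u) / (2 * Real.pi)) := by
  set v : ℂ := 1 / 2 + I * t + I * u with hv
  have hre : v.re = 1 / 2 := by simp [hv]
  have him : v.im = t + u := by simp [hv]
  rw [aux_gammaR_Q a (by rw [hre]; norm_num), ← HurwitzZeta.completedHurwitzZetaEven_one_sub,
    ← HurwitzZeta.completedCosZeta_one_sub]
  have hM := (auxg_mellin a ha ha' x hx hx2 (s := 1 - v) (by simp [hre]; norm_num)
    (by simp [hre])).2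
  rw [mellin_eq_fourier] at hM
  have hre' : (1 - v).re = 1 / 2 := by simp [hre]; norm_num
  have him' : (1 - v).im = -(t + u) := by simp [him]
  rw [hre', him', neg_sub] at hM
  unfold auxh
  rw [hM]
  ring

open scoped FourierTransform in
/-- Parseval–Plancherel identity for `I_{x,k}`. -/
theorem second_moment_Ixk_eq (a : ℝ) (ha : 0 < a) (ha' : a ≤ 1 / 2) (k : ℝ) (hk : 0 < k)
    (x : ℂ) (hx : ‖x‖ = 1) (harg : |(Complex.log x).im| < Real.pi / 4) :
    (1 / (2 * Real.pi)) *
        ∫ t : ℝ, (‖Ixk x k (1 / 2 + Complex.I * t) a‖) ^ 2 =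
      (1 / Real.pi ^ 2) *
        ∫ w in Set.Ioi (0 : ℝ),
          (Real.sin (k * Real.log w) / Real.log w) ^ 2 *
            (‖Gc a (x * w) - 1 - 1 / (x * w)‖) ^ 2 := by
  have ha1 : a < 1 := by linarith
  have hpi := Real.pi_pos
  rw [Complex.log_im, abs_lt] at harg
  have hx0 : x ≠ 0 := by rintro rfl; simp at hx
  have hxre : 0 < x.re := by
    have h := abs_arg_lt_pi_div_two_iff.mp (abs_lt.mpr ⟨by linarith [harg.1], by linarith [harg.2]⟩ :
      |arg x| < Real.pi / 2)
    exact h.resolve_right hx0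
  have hx2 : 0 < (x ^ 2).re := by
    have e : x ^ 2 = cexp (((2 * arg x : ℝ) : ℂ) * I) := by
      conv_lhs => rw [← norm_mul_exp_arg_mul_I x, hx]
      rw [ofReal_one, one_mul, ← Complex.exp_nat_mul]
      congr 1; push_cast; ring
    rw [e, exp_ofReal_mul_I_re]
    exact Real.cos_pos_of_mem_Ioo ⟨by linarith [harg.1], by linarith [harg.2]⟩
  set h := auxh a x with hh
  have h1 : Integrable h := auxh_integrable a ha ha1 x hxre hx2
  have h2 : Integrable (fun y => ‖h y‖ ^ 2) := auxh_sq_integrable a ha ha1 x hxre hx2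
  set H : ℝ → ℂ := fun y : ℝ => ((2 * (Real.sin (k * y) / y) : ℝ) : ℂ) * h y with hH
  have hmeas : Measurable fun y : ℝ => ((2 * (Real.sin (k * y) / y) : ℝ) : ℂ) := by fun_prop
  have hbound : ∀ y : ℝ, ‖((2 * (Real.sin (k * y) / y) : ℝ) : ℂ)‖ ≤ 2 * k := by
    intro y
    rw [norm_real, Real.norm_eq_abs, abs_mul, abs_two, abs_div]
    refine mul_le_mul_of_nonneg_left ?_ zero_le_two
    by_cases hy : y = 0
    · simp [hy, hk.le]
    · rw [div_le_iff₀ (abs_pos.mpr hy)]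
      refine Real.abs_sin_le_abs.trans ?_
      rw [abs_mul, abs_of_pos hk]
  have H1 : Integrable H :=
    h1.bdd_mul hmeas.aestronglyMeasurable (Filter.Eventually.of_forall hbound)
  have H2 : MemLp H 2 := by
    rw [memLp_two_iff_integrable_sq_norm H1.aestronglyMeasurable]
    have hmeas2 : AEStronglyMeasurable (fun y => ‖H y‖ ^ 2) volume :=
      H1.aestronglyMeasurable.norm.pow 2
    refine (h2.const_mul ((2 * k) ^ 2)).mono' hmeas2 (Filter.Eventually.of_forall fun y => ?_)
    rw [Real.norm_of_nonneg (by positivity), hH]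
    change ‖((2 * (Real.sin (k * y) / y) : ℝ) : ℂ) * h y‖ ^ 2 ≤ _
    rw [norm_mul, mul_pow]
    exact mul_le_mul_of_nonneg_right (pow_le_pow_left₀ (norm_nonneg _) (hbound y) 2)
      (by positivity)
  have hI : ∀ t : ℝ, ‖Ixk x k (1 / 2 + I * t) a‖ ^ 2 =
      (1 / (2 * Real.pi)) ^ 2 * ‖𝓕 H (t / (-(2 * Real.pi)))‖ ^ 2 := by
    intro t
    have e : Ixk x k (1 / 2 + I * t) a = ((1 / (2 * Real.pi) : ℝ) : ℂ) * 𝓕 H (-t / (2 * Real.pi)) := by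
      rw [Ixk, ← aux_fubini h1 hk t]
      rw [intervalIntegral.integral_congr fun u _ => aux_integrand a ha ha1 x hxre hx2 t u]
      have : (Real.pi : ℂ) ≠ 0 := by exact_mod_cast hpi.ne'
      push_cast
      field_simp
      rfl
    rw [e, norm_mul, mul_pow, norm_real, Real.norm_of_nonneg (by positivity), neg_div, div_neg]
  have hLHS : ∫ t : ℝ, (‖Ixk x k (1 / 2 + Complex.I * t) a‖) ^ 2 =
      (1 / (2 * Real.pi)) * ∫ y, ‖H y‖ ^ 2 := by
    simp only [hI]
    rw [integral_const_mul, Measure.integral_comp_div (fun r => ‖𝓕 H r‖ ^ 2), aux_plancherel H1 H2,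
      abs_neg, abs_of_pos (by positivity), smul_eq_mul]
    field_simp
  have hRHS : ∫ w in Set.Ioi (0 : ℝ), (Real.sin (k * Real.log w) / Real.log w) ^ 2 *
            (‖Gc a (x * w) - 1 - 1 / (x * w)‖) ^ 2 = (1 / 4) * ∫ y, ‖H y‖ ^ 2 := by
    rw [aux_cov_integral, ← integral_const_mul]
    refine integral_congr_ae (Filter.Eventually.of_forall fun y => ?_)
    have hw := Real.exp_pos (-y)
    have hG : Gc a (x * (Real.exp (-y) : ℝ)) = auxTh a ((x * (Real.exp (-y) : ℝ)) ^ 2) := by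
      refine (auxTh_hasSum a ?_).tsum_eq
      rw [mul_pow, ← ofReal_pow, re_mul_ofReal]
      positivity
    simp only [hH]
    rw [hG, ← auxg_eq a x hw, norm_mul, mul_pow, hh, auxh_sq, norm_real, Real.norm_eq_abs, sq_abs,
      Real.log_exp, mul_neg, Real.sin_neg, neg_div_neg_eq, smul_eq_mul]
    ring
  rw [hLHS, hRHS]
  field_simp
  ring
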